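/- arXiv:1606.06412 — 2 statements merged into one kernel-verified Lean document; each statement's English description precedes it below -/
import Mathlib

section
/- If G is a connected finite simple graph and D is an effective divisor of G, then for every vertex v ∈ V(G) there exists a unique v-reduced effective divisor D' equivalent to D. -/
open SimpleGraph Finset
open scoped Classical

noncomputable section

def lap {V : Type} [Fintype V] (G : SimpleGraph V) (S : V → ℤ) : V → ℤ :=
  fun v => ∑ w : V, if G.Adj v w then S v - S w else 0

def Effective {V : Type} (D : V → ℤ) : Prop := ∀ v, 0 ≤ D v

def degDiv {V : Type} [Fintype V] (D : V → ℤ) : ℤ := ∑ v, D v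

def LinEquiv {V : Type} [Fintype V] (G : SimpleGraph V) (D D' : V → ℤ) : Prop :=
  ∃ S : V → ℤ, D' = D - lap G S

def PosRank {V : Type} [Fintype V] (G : SimpleGraph V) (D : V → ℤ) : Prop :=
  ∀ v : V, ∃ D' : V → ℤ, Effective D' ∧ LinEquiv G D D' ∧ 1 ≤ D' v

def gonality {V : Type} [Fintype V] (G : SimpleGraph V) : ℕ :=
  sInf {n : ℕ | ∃ D : V → ℤ, Effective D ∧ PosRank G D ∧ degDiv D = (n : ℤ)}

def indic {V : Type} (A : Set V) : V → ℤ := fun v => if v ∈ A then 1 else 0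

/-- An effective divisor `D` is `v`-reduced if there is no non-empty `A ⊆ V(G)`
with `v ∉ A` such that `D - Q·1_A` is effective. -/
def VReduced {V : Type} [Fintype V] (G : SimpleGraph V) (v : V) (D : V → ℤ) : Prop :=
  Effective D ∧ ¬ ∃ A : Set V, A.Nonempty ∧ v ∉ A ∧ Effective (D - lap G (indic A))

section Laplacian

variable {V : Type} [Fintype V] {G : SimpleGraph V}

theorem lap_add (S T : V → ℤ) : lap G (S + T) = lap G S + lap G T := by
  funext v
  simp only [lap, Pi.add_apply, ← Finset.sum_add_distrib]
  refine Finset.sum_congr rfl fun w _ => ?_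
  split_ifs <;> ring

theorem lap_neg (S : V → ℤ) : lap G (-S) = -lap G S := by
  funext v
  simp only [lap, Pi.neg_apply, ← Finset.sum_neg_distrib]
  refine Finset.sum_congr rfl fun w _ => ?_
  split_ifs <;> ring

theorem lap_sub (S T : V → ℤ) : lap G (S - T) = lap G S - lap G T := by
  rw [sub_eq_add_neg, lap_add, lap_neg, sub_eq_add_neg]

theorem lap_eq_zero_of_forall_eq {S : V → ℤ} (h : ∀ a b, S a = S b) : lap G S = 0 := by
  funext v
  exact Finset.sum_eq_zero fun w _ => by rw [h v w, sub_self, ite_self]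

theorem degDiv_lap (S : V → ℤ) : degDiv (lap G S) = 0 := by
  have h : degDiv (lap G S) = -degDiv (lap G S) := by
    conv_lhs => rw [degDiv]; simp only [lap]; rw [Finset.sum_comm]
    simp only [degDiv, lap, ← Finset.sum_neg_distrib]
    refine Finset.sum_congr rfl fun v _ => Finset.sum_congr rfl fun w _ => ?_
    simp only [G.adj_comm w v]
    split_ifs <;> ring
  omega

theorem degDiv_sub_lap (D S : V → ℤ) : degDiv (D - lap G S) = degDiv D := by
  have h := degDiv_lap (G := G) S
  simp only [degDiv, Pi.sub_apply, Finset.sum_sub_distrib] at h ⊢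
  omega

/-- On a connected graph the functions with vanishing Laplacian are constant. -/
theorem SimpleGraph.Connected.eq_of_lap_eq_zero (hG : G.Connected) {S : V → ℤ}
    (h : lap G S = 0) (a b : V) : S a = S b := by
  have := hG.nonempty
  obtain ⟨m, hm⟩ := Finite.exists_max S
  have step : ∀ x y, G.Adj x y → S x = S m → S y = S m := by
    intro x y hxy hx
    have h0 : ∑ w : V, (if G.Adj x w then S x - S w else 0) = 0 := congrFun h x
    have hnonneg : ∀ w ∈ Finset.univ, 0 ≤ if G.Adj x w then S x - S w else 0 := by
      intro w _
      have := hm w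
      split_ifs <;> omega
    have := (Finset.sum_eq_zero_iff_of_nonneg hnonneg).1 h0 y (Finset.mem_univ y)
    rw [if_pos hxy] at this
    omega
  have walk : ∀ x y, G.Walk x y → S x = S m → S y = S m := by
    intro x y p
    induction p with
    | nil => exact id
    | cons hadj _ ih => exact fun hx => ih (step _ _ hadj hx)
  have hall : ∀ x, S x = S m := fun x => (hG.preconnected m x).elim fun p => walk m x p rfl
  rw [hall a, hall b]

theorem Effective.le_degDiv {D : V → ℤ} (hD : Effective D) (v : V) : D v ≤ degDiv D :=
  Finset.single_le_sum (fun w _ => hD w) (Finset.mem_univ v)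

theorem finite_effective_degDiv_eq (d : ℤ) :
    {D : V → ℤ | Effective D ∧ degDiv D = d}.Finite := by
  refine (Set.finite_Icc (0 : V → ℤ) fun _ => d).subset ?_
  rintro D ⟨hD, rfl⟩
  exact ⟨hD, hD.le_degDiv⟩

/-- On a connected graph only finitely many functions vanishing at `v` turn `D` into an
effective divisor. -/
theorem SimpleGraph.Connected.finite_effective_sub_lap (hG : G.Connected) (D : V → ℤ) (v : V) :
    {S : V → ℤ | S v = 0 ∧ Effective (D - lap G S)}.Finite := by
  refine Set.Finite.of_finite_image (f := fun S => D - lap G S)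
    ((finite_effective_degDiv_eq (degDiv D)).subset ?_) ?_
  · rintro _ ⟨S, hS, rfl⟩
    exact ⟨hS.2, degDiv_sub_lap D S⟩
  · intro S hS T hT hST
    have h0 : lap G (S - T) = 0 := by rw [lap_sub, sub_eq_zero]; exact sub_right_injective hST
    funext x
    have := hG.eq_of_lap_eq_zero h0 x v
    simp only [Pi.sub_apply, hS.1, hT.1] at this
    omega

/-- Firing the set where `S` is maximal keeps `D` effective if firing `S` does. -/
theorem Effective.sub_lap_indic_isMax {D S : V → ℤ} (hD : Effective D)
    (hS : Effective (D - lap G S)) : Effective (D - lap G (indic {x | ∀ y, S y ≤ S x})) := by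
  intro w
  by_cases hw : ∀ y, S y ≤ S w
  · refine (hS w).trans (sub_le_sub_left (Finset.sum_le_sum fun u _ => ?_) _)
    have hu := hw u
    by_cases hmax : ∀ y, S y ≤ S u
    · simp only [indic, Set.mem_ofPred_eq, if_pos hw, if_pos hmax]
      split_ifs <;> omega
    · have hlt : S u < S w := by
        by_contra! hle
        exact hmax fun y => (hw y).trans hle
      simp only [indic, Set.mem_ofPred_eq, if_pos hw, if_neg hmax]
      split_ifs <;> omega
  · refine (hD w).trans (le_sub_self_iff _ |>.2 (Finset.sum_nonpos fun u _ => ?_))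
    simp only [indic, Set.mem_ofPred_eq, if_neg hw]
    split_ifs <;> omega

theorem VReduced.le_apply {v : V} {D S : V → ℤ} (hD : VReduced G v D)
    (hS : Effective (D - lap G S)) (x : V) : S x ≤ S v := by
  have : Nonempty V := ⟨v⟩
  by_contra hx
  exact hD.2 ⟨{x | ∀ y, S y ≤ S x}, Finite.exists_max S, fun hv => hx (hv x),
    hD.1.sub_lap_indic_isMax hS⟩

theorem VReduced.eq_of_linEquiv {v : V} {D D' : V → ℤ} (hD : VReduced G v D)
    (hD' : VReduced G v D') (h : LinEquiv G D D') : D' = D := by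
  obtain ⟨S, rfl⟩ := h
  have hmax := hD.le_apply hD'.1
  have hmin := hD'.le_apply (S := -S) (by simpa [lap_neg] using hD.1)
  have hconst : ∀ x, S x = S v := fun x => le_antisymm (hmax x) (neg_le_neg_iff.1 (hmin x))
  rw [lap_eq_zero_of_forall_eq fun a b => (hconst a).trans (hconst b).symm, sub_zero]

theorem SimpleGraph.Connected.exists_vReduced (hG : G.Connected) {D : V → ℤ}
    (hD : Effective D) (v : V) : ∃ D', LinEquiv G D D' ∧ VReduced G v D' := by
  have h0 : lap G (0 : V → ℤ) = 0 := lap_eq_zero_of_forall_eq fun _ _ => rfl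
  obtain ⟨S, ⟨hSv, hS⟩, hmax⟩ := Set.exists_max_image _ degDiv
    (hG.finite_effective_sub_lap D v) ⟨0, rfl, by simpa [h0] using hD⟩
  refine ⟨D - lap G S, ⟨S, rfl⟩, hS, ?_⟩
  rintro ⟨A, ⟨a, ha⟩, hvA, hA⟩
  have hle := hmax (S + indic A)
    ⟨by simp [hSv, indic, hvA], by rwa [lap_add, ← sub_sub]⟩
  have hind : Effective (indic A) := fun x => by simp only [indic]; split_ifs <;> decide
  have hpos := hind.le_degDiv a
  simp only [indic, if_pos ha] at hpos
  simp only [degDiv, Pi.add_apply, Finset.sum_add_distrib, indic] at hle hpos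
  omega

theorem LinEquiv.trans_of_left {D D₁ D₂ : V → ℤ} (h₁ : LinEquiv G D D₁)
    (h₂ : LinEquiv G D D₂) : LinEquiv G D₁ D₂ := by
  obtain ⟨S, rfl⟩ := h₁
  obtain ⟨T, rfl⟩ := h₂
  exact ⟨T - S, by rw [lap_sub]; abel⟩

end Laplacian

/-- If `G` is a connected graph and `D` is an effective divisor of `G`, then for
every vertex `v` there exists a unique `v`-reduced effective divisor equivalent
to `D`. -/
theorem stmt_4 {V : Type} [Fintype V] (G : SimpleGraph V) (hG : G.Connected)
    (D : V → ℤ) (hD : Effective D) (v : V) :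
    ∃! D' : V → ℤ, LinEquiv G D D' ∧ VReduced G v D' := by
  obtain ⟨D', hequiv, hred⟩ := hG.exists_vReduced hD v
  exact ⟨D', ⟨hequiv, hred⟩, fun D'' h => hred.eq_of_linEquiv h.2 (hequiv.trans_of_left h.1)⟩
end
end

section
/- For every integer t ≥ 0 there exist connected finite simple graphs G and H such that H is a minor of G, gon(G) = 2 and gon(H) > t. -/
open SimpleGraph Finset
open scoped Classical

noncomputable section

/-- `H` is a minor of `G`: there is a family of pairwise disjoint, nonempty,
connected branch sets in `G`, one for each vertex of `H`, such that adjacent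
vertices of `H` have adjacent branch sets.  (This is the standard equivalent of
obtaining `H` from a subgraph of `G` by contracting edges.) -/
def IsMinor {W V : Type} (H : SimpleGraph W) (G : SimpleGraph V) : Prop :=
  ∃ φ : W → Set V,
    (∀ w, (φ w).Nonempty) ∧
    (∀ w, (G.induce (φ w)).Connected) ∧
    (∀ w w', w ≠ w' → Disjoint (φ w) (φ w')) ∧
    (∀ w w', H.Adj w w' → ∃ u ∈ φ w, ∃ u' ∈ φ w', G.Adj u u')

theorem sum_lap {V : Type} [Fintype V] (G : SimpleGraph V) (S : V → ℤ) (A : Finset V) :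
    ∑ v ∈ A, lap G S v = ∑ v ∈ A, ∑ w ∈ Aᶜ, if G.Adj v w then S v - S w else 0 := by
  have hA : ∑ v ∈ A, ∑ w ∈ A, (if G.Adj v w then S v - S w else 0) = 0 := by
    have h : ∑ v ∈ A, ∑ w ∈ A, (if G.Adj v w then S v - S w else 0) =
        -∑ v ∈ A, ∑ w ∈ A, (if G.Adj v w then S v - S w else 0) := by
      conv_lhs => rw [Finset.sum_comm]
      simp only [← Finset.sum_neg_distrib]
      refine Finset.sum_congr rfl fun v _ => Finset.sum_congr rfl fun w _ => ?_
      simp only [G.adj_comm w v]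
      split_ifs <;> ring
    omega
  have h : ∀ v, lap G S v = ∑ w ∈ A, (if G.Adj v w then S v - S w else 0) +
      ∑ w ∈ Aᶜ, (if G.Adj v w then S v - S w else 0) := fun v =>
    (Finset.sum_add_sum_compl A _).symm
  simp only [h, Finset.sum_add_distrib, hA, zero_add]

theorem degDiv_eq_of_linEquiv {V : Type} [Fintype V] {G : SimpleGraph V} {D D' : V → ℤ}
    (h : LinEquiv G D D') : degDiv D' = degDiv D := by
  obtain ⟨S, rfl⟩ := h
  have := sum_lap G S Finset.univ
  simp only [Finset.compl_univ, Finset.sum_empty, Finset.sum_const_zero] at this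
  simp [degDiv, this]

theorem lap_neg_s9 {V : Type} [Fintype V] (G : SimpleGraph V) (S : V → ℤ) (v : V) :
    lap G (fun w => -S w) v = -lap G S v := by
  simp only [lap, ← Finset.sum_neg_distrib]
  refine Finset.sum_congr rfl fun w _ => ?_
  split_ifs <;> ring

/-- If `c` is adjacent to every other vertex and `lap G S` is bounded by an effective divisor,
then `S` exceeds `S c` on at most as many vertices as the divisor has chips. -/
theorem card_lt_le_degDiv {V : Type} [Fintype V] {G : SimpleGraph V} {c : V}
    (hc : ∀ v, v ≠ c → G.Adj v c) {S E : V → ℤ} (hE : Effective E) (hS : ∀ v, lap G S v ≤ E v) :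
    ((Finset.univ.filter fun v => S c < S v).card : ℤ) ≤ degDiv E := by
  set A := Finset.univ.filter fun v => S c < S v with hA
  have hmem : ∀ v, v ∈ A ↔ S c < S v := by simp [hA]
  calc (A.card : ℤ) = ∑ v ∈ A, 1 := by simp
    _ ≤ ∑ v ∈ A, ∑ w ∈ Aᶜ, (if G.Adj v w then S v - S w else 0) := by
        refine Finset.sum_le_sum fun v hv => ?_
        have hv' := (hmem v).1 hv
        have hcA : c ∈ Aᶜ := by simp [hmem]
        have hvc : G.Adj v c := hc v (by rintro rfl; exact lt_irrefl _ hv')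
        have h1 : (if G.Adj v c then S v - S c else 0) ≤
            ∑ w ∈ Aᶜ, (if G.Adj v w then S v - S w else 0) := by
          refine Finset.single_le_sum (f := fun w => if G.Adj v w then S v - S w else 0)
            (fun w hw => ?_) hcA
          have hw' : ¬ S c < S w := by rw [← hmem]; simpa using hw
          split_ifs <;> omega
        rw [if_pos hvc] at h1
        omega
    _ = ∑ v ∈ A, lap G S v := (sum_lap G S A).symm
    _ ≤ ∑ v ∈ A, E v := Finset.sum_le_sum fun v _ => hS v
    _ ≤ degDiv E := Finset.sum_le_univ_sum_of_nonneg hE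

theorem card_ne_le_of_linEquiv {V : Type} [Fintype V] {G : SimpleGraph V} {c : V}
    (hc : ∀ v, v ≠ c → G.Adj v c) {S D : V → ℤ} (hD : Effective D)
    (hD' : Effective (D - lap G S)) :
    ((Finset.univ.filter fun v => S v ≠ S c).card : ℤ) ≤ 2 * degDiv D := by
  have h1 := card_lt_le_degDiv hc hD (S := S) fun v => by simpa using hD' v
  have h2 := card_lt_le_degDiv hc hD' (S := fun v => -S v) fun v => by
    rw [lap_neg_s9]; simpa using hD v
  rw [degDiv_eq_of_linEquiv ⟨S, rfl⟩] at h2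
  have h3 : (Finset.univ.filter fun v => S v ≠ S c) ⊆
      (Finset.univ.filter fun v => S c < S v) ∪ Finset.univ.filter fun v => -S c < -S v := by
    intro v
    simp only [Finset.mem_filter, Finset.mem_univ, true_and, Finset.mem_union]
    omega
  have h4 := (Finset.card_le_card h3).trans (Finset.card_union_le _ _)
  omega

/-- Maximum principle for sequences with `3 f(u) ≤ f(u - 1) + f(u + 1)`. -/
theorem nonpos_of_three_mul_le {f : ℕ → ℤ} {a b : ℕ} (ha : f a = 0) (hb : f b = 0)
    (h : ∀ u, a ≤ u → u + 2 ≤ b → 3 * f (u + 1) ≤ f u + f (u + 2)) :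
    ∀ u, a ≤ u → u ≤ b → f u ≤ 0 := by
  intro u hau hub
  obtain ⟨m, hm, hmax⟩ := Finset.exists_max_image (Finset.Icc a b) f
    ⟨u, Finset.mem_Icc.2 ⟨hau, hub⟩⟩
  refine (hmax u (Finset.mem_Icc.2 ⟨hau, hub⟩)).trans ?_
  rw [Finset.mem_Icc] at hm
  rcases eq_or_lt_of_le hm.1 with rfl | h1
  · exact ha.le
  rcases eq_or_lt_of_le hm.2 with rfl | h2
  · exact hb.le
  obtain ⟨p, rfl⟩ : ∃ p, m = p + 1 := ⟨m - 1, by omega⟩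
  have e1 := h p (by omega) (by omega)
  have e2 := hmax p (Finset.mem_Icc.2 ⟨by omega, by omega⟩)
  have e3 := hmax (p + 2) (Finset.mem_Icc.2 ⟨by omega, by omega⟩)
  omega

theorem le_three_mul_of_zeros {f : ℕ → ℤ} {a v b c : ℕ} (hav : a ≤ v) (hvb : v + 1 < b)
    (hbc : b < c) (ha : f a = 0) (hb : f b = 0) (hc : f c = 0)
    (h : ∀ u, a ≤ u → u + 2 ≤ c → 3 * f (u + 1) ≤ f u + f (u + 2)) :
    f v + f (v + 2) ≤ 3 * f (v + 1) := by
  have hle := nonpos_of_three_mul_le ha hc h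
  by_contra! hlt
  have hneg : ∀ k, v + 1 + k < c → f (v + 1 + k) < 0 := by
    intro k
    induction k with
    | zero =>
      intro _
      have := hle v (by omega) (by omega)
      have := hle (v + 2) (by omega) (by omega)
      simp only [add_zero]
      omega
    | succ k ih =>
      intro hk
      have h1 := ih (by omega)
      have h2 := h (v + 1 + k) (by omega) (by omega)
      have h3 := hle (v + 1 + k + 2) (by omega) (by omega)
      rw [← add_assoc]
      omega
  have := hneg (b - (v + 1)) (by omega)
  rw [show v + 1 + (b - (v + 1)) = b by omega] at this
  omega

theorem connected_of_descent {V : Type} (G : SimpleGraph V) (f : V → ℕ) (r : V)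
    (h : ∀ x, x ≠ r → ∃ y, G.Adj x y ∧ f y < f x) : G.Connected := by
  have hr : ∀ n x, f x = n → G.Reachable x r := by
    intro n
    induction n using Nat.strong_induction_on with
    | _ n ih =>
      intro x hx
      by_cases hxr : x = r
      · rw [hxr]
      · obtain ⟨y, hy, hlt⟩ := h x hxr
        exact hy.reachable.trans (ih (f y) (hx ▸ hlt) y rfl)
  have : Nonempty V := ⟨r⟩
  exact ⟨fun x y => (hr _ x rfl).trans (hr _ y rfl).symm⟩

/-- In a connected graph all of whose edges lie in 4-cycles, an effective
divisor of positive rank has degree at least two. -/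
theorem two_le_degDiv {V : Type} [Fintype V] {G : SimpleGraph V} (hG : G.Connected)
    (hcard : 2 ≤ Fintype.card V)
    (hcyc : ∀ p w, G.Adj p w → ∃ a b, G.Adj p a ∧ G.Adj a b ∧ G.Adj b w ∧ a ≠ w ∧ b ≠ p)
    {D : V → ℤ} (hD : Effective D) (hr : PosRank G D) : 2 ≤ degDiv D := by
  by_contra! hlt
  have hone : ∀ a b, a ≠ b → D a + D b ≤ 1 := by
    intro a b hab
    have := Finset.sum_le_univ_sum_of_nonneg (s := {a, b}) hD
    rw [Finset.sum_pair hab] at this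
    exact this.trans (by unfold degDiv at hlt; omega)
  obtain ⟨z, hz⟩ : ∃ z, D z = 0 := by
    obtain ⟨a, b, hab⟩ := Fintype.one_lt_card_iff.1 hcard
    have := hone a b hab
    have := hD a
    have := hD b
    by_cases h : D a = 0
    · exact ⟨a, h⟩
    · exact ⟨b, by omega⟩
  obtain ⟨_, hD', ⟨S, rfl⟩, hz'⟩ := hr z
  have : Nonempty V := ⟨z⟩
  obtain ⟨m, hm⟩ := Finite.exists_max S
  have hlap : ∀ v, lap G S v ≤ D v := fun v => by simpa using hD' v
  have hout : ∀ v, S v = S m → ∀ B : Finset V, (∀ w ∈ B, G.Adj v w ∧ S w ≠ S m) →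
      (B.card : ℤ) ≤ D v := by
    intro v hv B hB
    refine le_trans ?_ (hlap v)
    calc (B.card : ℤ) = ∑ w ∈ B, 1 := by simp
      _ ≤ ∑ w ∈ B, (if G.Adj v w then S v - S w else 0) := by
          refine Finset.sum_le_sum fun w hw => ?_
          have := hm w
          have := (hB w hw).2
          rw [if_pos (hB w hw).1]
          omega
      _ ≤ lap G S v := by
          refine Finset.sum_le_univ_sum_of_nonneg fun w => ?_
          have := hm w
          split_ifs <;> omega
  obtain ⟨q, hq⟩ : ∃ q, S q ≠ S m := by
    by_contra! hconst
    have : lap G S z = 0 := by simp [lap, hconst]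
    simp [hz, this] at hz'
  obtain ⟨walk⟩ := hG.preconnected m q
  obtain ⟨d, -, hp, hw⟩ := walk.exists_boundary_dart {x | S x = S m} rfl hq
  obtain ⟨a, b, hpa, hab, hbw, haw, hbp⟩ := hcyc d.fst d.snd d.adj
  simp only [Set.mem_ofPred_eq] at hp hw
  have hDp := hout d.fst hp {d.snd} fun w hw' => by
    rw [Finset.mem_singleton.1 hw']
    exact ⟨d.adj, hw⟩
  have hzero : ∀ x, x ≠ d.fst → D x ≤ 0 := fun x hx => by
    have := hone x d.fst hx
    simp at hDp
    omega
  have hMa : S a = S m := by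
    by_contra ha
    have h2 := hout d.fst hp {a, d.snd} (by
      intro w hw'
      rcases Finset.mem_insert.1 hw' with rfl | hw'
      · exact ⟨hpa, ha⟩
      · rw [Finset.mem_singleton.1 hw']
        exact ⟨d.adj, hw⟩)
    rw [Finset.card_pair haw] at h2
    have := hone d.fst a hpa.ne
    have := hD a
    push_cast at h2
    omega
  have hstep : ∀ x y, x ≠ d.fst → S x = S m → G.Adj x y → S y = S m := by
    intro x y hx hSx hxy
    by_contra hy
    have := hout x hSx {y} (by simpa using ⟨hxy, hy⟩)
    have := hzero x hx
    simp at *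
    omega
  exact hw (hstep b _ hbp (hstep a b hpa.ne' hMa hab) hbw)

/-- The fan: vertices `1, …, N` form a path, and `0` is adjacent to all of them. -/
def fan (N : ℕ) : SimpleGraph (Fin (N + 1)) where
  Adj i j := i ≠ j ∧ (i.val = 0 ∨ j.val = 0 ∨ i.val + 1 = j.val ∨ j.val + 1 = i.val)
  symm := ⟨fun _ _ h => ⟨h.1.symm, by tauto⟩⟩
  loopless := ⟨fun _ h => h.1 rfl⟩

/-- The ladder with `N` rungs; the `k`-th rung joins `2 * k` and `2 * k + 1`. -/
def ladder (N : ℕ) : SimpleGraph (Fin (2 * N)) where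
  Adj i j := i ≠ j ∧ (i.val / 2 = j.val / 2 ∨ i.val + 2 = j.val ∨ j.val + 2 = i.val)
  symm := ⟨fun _ _ h => ⟨h.1.symm, by have := h.2; omega⟩⟩
  loopless := ⟨fun _ h => h.1 rfl⟩

theorem fan_adj_zero {N : ℕ} (v : Fin (N + 1)) (hv : v ≠ 0) : (fan N).Adj v 0 :=
  ⟨hv, by simp⟩

theorem fan_connected (N : ℕ) : (fan N).Connected :=
  connected_of_descent _ Fin.val 0 fun x hx =>
    ⟨0, fan_adj_zero x hx, Nat.pos_of_ne_zero fun h => hx (Fin.ext h)⟩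

theorem ladder_connected {N : ℕ} (hN : 0 < N) : (ladder N).Connected := by
  refine connected_of_descent _ Fin.val ⟨0, by omega⟩ fun x hx => ?_
  have hx' : x.val ≠ 0 := fun h => hx (Fin.ext h)
  have := x.isLt
  by_cases h1 : x.val = 1
  · exact ⟨⟨0, by omega⟩, ⟨hx, by simp [h1]⟩, by simp [h1]⟩
  · refine ⟨⟨x.val - 2, by omega⟩, ⟨fun h => ?_, ?_⟩, ?_⟩
    · have := congrArg Fin.val h
      simp only at this
      omega
    · simp only
      omega
    · simp only
      omega

theorem fan_isMinor_ladder {N : ℕ} (hN : 0 < N) : IsMinor (fan N) (ladder N) := by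
  refine ⟨fun w => {x | if w.val = 0 then x.val % 2 = 1 else x.val + 2 = 2 * w.val},
    fun w => ?_, fun w => ?_, fun w w' hne => ?_, fun w w' hadj => ?_⟩
  · have := w.isLt
    by_cases hw : w.val = 0
    · exact ⟨⟨1, by omega⟩, by simp [hw]⟩
    · refine ⟨⟨2 * w.val - 2, by omega⟩, ?_⟩
      simp only [hw, Set.mem_ofPred_eq, if_false]
      omega
  · have := w.isLt
    by_cases hw : w.val = 0
    · refine connected_of_descent _ (fun x => x.1.val) ⟨⟨1, by omega⟩, by simp [hw]⟩ ?_
      rintro ⟨⟨x, hx⟩, hxm⟩ hne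
      simp only [hw, Set.mem_ofPred_eq, if_true] at hxm
      have hx1 : x ≠ 1 := by rintro rfl; exact hne rfl
      refine ⟨⟨⟨x - 2, by omega⟩, ?_⟩, ⟨fun h => ?_, ?_⟩, ?_⟩
      · simp only [hw, Set.mem_ofPred_eq, if_true]
        omega
      · have := congrArg Fin.val h
        simp at this
        omega
      · simp
        omega
      · simp only
        omega
    · refine connected_of_descent _ (fun x => x.1.val) ⟨⟨2 * w.val - 2, by omega⟩, ?_⟩ ?_
      · simp only [hw, Set.mem_ofPred_eq, if_false]
        omega
      · rintro ⟨⟨x, hx⟩, hxm⟩ hne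
        simp only [hw, Set.mem_ofPred_eq, if_false] at hxm
        refine absurd ?_ hne
        simp only [Subtype.mk.injEq, Fin.mk.injEq]
        omega
  · have hne' : w.val ≠ w'.val := fun h => hne (Fin.ext h)
    rw [Set.disjoint_left]
    intro x hx hx'
    simp only [Set.mem_ofPred_eq] at hx hx'
    split_ifs at hx hx' <;> omega
  · have := w.isLt
    have := w'.isLt
    obtain ⟨hne, h⟩ := hadj
    have hne' : w.val ≠ w'.val := fun h => hne (Fin.ext h)
    refine ⟨⟨if w.val = 0 then 2 * w'.val - 1 else 2 * w.val - 2, by split_ifs <;> omega⟩, ?_,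
      ⟨if w'.val = 0 then 2 * w.val - 1 else 2 * w'.val - 2, by split_ifs <;> omega⟩, ?_,
      fun h => ?_, ?_⟩
    · simp only [Set.mem_ofPred_eq]
      split_ifs <;> omega
    · simp only [Set.mem_ofPred_eq]
      split_ifs <;> omega
    · have := congrArg Fin.val h
      simp only at this
      split_ifs at this <;> omega
    · simp only
      split_ifs <;> omega

theorem ladder_edge_mem_cycle {N : ℕ} (hN : 2 ≤ N) (p w : Fin (2 * N))
    (h : (ladder N).Adj p w) : ∃ a b, (ladder N).Adj p a ∧ (ladder N).Adj a b ∧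
      (ladder N).Adj b w ∧ a ≠ w ∧ b ≠ p := by
  obtain ⟨p, hp⟩ := p
  obtain ⟨w, hw⟩ := w
  simp only [ladder, ne_eq, Fin.mk.injEq] at h
  suffices H : ∃ a b : ℕ, ∃ (_ : a < 2 * N) (_ : b < 2 * N),
      (p ≠ a ∧ (p / 2 = a / 2 ∨ p + 2 = a ∨ a + 2 = p)) ∧
      (a ≠ b ∧ (a / 2 = b / 2 ∨ a + 2 = b ∨ b + 2 = a)) ∧
      (b ≠ w ∧ (b / 2 = w / 2 ∨ b + 2 = w ∨ w + 2 = b)) ∧ a ≠ w ∧ b ≠ p by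
    obtain ⟨a, b, ha, hb, H⟩ := H
    exact ⟨⟨a, ha⟩, ⟨b, hb⟩, by simpa [ladder, Fin.ext_iff] using H⟩
  by_cases h1 : p / 2 = w / 2
  · by_cases h2 : 2 ≤ p
    · exact ⟨p - 2, w - 2, by omega, by omega, by omega⟩
    · exact ⟨p + 2, w + 2, by omega, by omega, by omega⟩
  · by_cases h2 : p % 2 = 0
    · exact ⟨p + 1, w + 1, by omega, by omega, by omega⟩
    · exact ⟨p - 1, w - 1, by omega, by omega, by omega⟩

theorem ladder_lap {N k : ℕ} (hk : k < N) (x : Fin (2 * N)) :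
    lap (ladder N) (fun y => ((k - y.val / 2 : ℕ) : ℤ)) x =
      (if x.val / 2 < k then 1 else 0) - (if 2 ≤ x.val ∧ x.val / 2 ≤ k then 1 else 0) := by
  have hx := x.isLt
  have hterm : ∀ w : Fin (2 * N), (if (ladder N).Adj x w then
      ((k - x.val / 2 : ℕ) : ℤ) - ((k - w.val / 2 : ℕ) : ℤ) else 0) =
      (if w.val = x.val + 2 then (if x.val / 2 < k then 1 else 0) else 0) -
      (if w.val + 2 = x.val then (if x.val / 2 ≤ k then 1 else 0) else 0) := by
    intro w
    simp only [ladder, ne_eq, Fin.ext_iff]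
    split_ifs <;> omega
  simp only [lap, hterm, Finset.sum_sub_distrib]
  congr 1
  · by_cases h : x.val / 2 < k
    · rw [Finset.sum_eq_single ⟨x.val + 2, by omega⟩] <;> simp [h, Fin.ext_iff]
    · simp [h]
  · by_cases h : 2 ≤ x.val
    · rw [Finset.sum_eq_single ⟨x.val - 2, by omega⟩]
      · simp [h]
      · intro w _ hw
        rw [if_neg]
        rintro h'
        exact hw (Fin.ext (by simp only; omega))
      · simp
    · rw [if_neg (c := 2 ≤ x.val ∧ x.val / 2 ≤ k) fun h' => h h'.1]
      refine Finset.sum_eq_zero fun w _ => if_neg ?_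
      omega

theorem gonality_ladder {N : ℕ} (hN : 2 ≤ N) : gonality (ladder N) = 2 := by
  have hmem : 2 ∈ {n : ℕ | ∃ D : Fin (2 * N) → ℤ, Effective D ∧ PosRank (ladder N) D ∧
      degDiv D = (n : ℤ)} := by
    refine ⟨fun x => if x.val < 2 then 1 else 0, fun x => ?_, fun v => ?_, ?_⟩
    · dsimp only
      split_ifs <;> omega
    · have hv := v.isLt
      have key : ∀ x : Fin (2 * N), ((fun x : Fin (2 * N) => if x.val < 2 then (1 : ℤ) else 0) -
          lap (ladder N) (fun y => ((v.val / 2 - y.val / 2 : ℕ) : ℤ))) x =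
          if x.val / 2 = v.val / 2 then 1 else 0 := by
        intro x
        rw [Pi.sub_apply, ladder_lap (by omega)]
        split_ifs <;> omega
      refine ⟨_, fun x => ?_,
        ⟨fun y => ((v.val / 2 - y.val / 2 : ℕ) : ℤ), rfl⟩, ?_⟩
      · rw [key]
        split_ifs <;> omega
      · rw [key, if_pos rfl]
    · have : (Finset.univ.filter fun x : Fin (2 * N) => x.val < 2) =
          {⟨0, by omega⟩, ⟨1, by omega⟩} := by
        ext x
        simp only [Finset.mem_filter, Finset.mem_univ, true_and, Finset.mem_insert,
          Finset.mem_singleton, Fin.ext_iff]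
        omega
      simp only [degDiv, Finset.sum_boole, this]
      rw [Finset.card_pair (by simp)]
  refine le_antisymm (Nat.sInf_le hmem) (le_csInf ⟨2, hmem⟩ ?_)
  rintro n ⟨D, hD, hr, hn⟩
  have := two_le_degDiv (ladder_connected (by omega)) (by simp; omega)
    (ladder_edge_mem_cycle hN) hD hr
  omega

theorem fan_lap {N u : ℕ} (hu : 1 ≤ u) (huN : u + 2 ≤ N) (S : Fin (N + 1) → ℤ) :
    lap (fan N) S ⟨u + 1, by omega⟩ = 3 * S ⟨u + 1, by omega⟩ - S 0 - S ⟨u, by omega⟩ -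
      S ⟨u + 2, by omega⟩ := by
  have hnbr : (Finset.univ.filter fun w => (fan N).Adj ⟨u + 1, by omega⟩ w) =
      {0, ⟨u, by omega⟩, ⟨u + 2, by omega⟩} := by
    ext w
    simp only [Finset.mem_filter, Finset.mem_univ, true_and, Finset.mem_insert,
      Finset.mem_singleton, Fin.ext_iff, fan, ne_eq, Fin.val_zero]
    omega
  rw [lap, ← Finset.sum_filter, hnbr, Finset.sum_insert, Finset.sum_pair]
  · ring
  · simp [Fin.ext_iff]
  · simp [Fin.ext_iff]
    omega

/-- A divisor of degree at most `t` misses one of `t + 1` consecutive blocks. -/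
theorem exists_block_eq_zero {t L N : ℕ} (hN : (t + 1) * L ≤ N) {D : Fin (N + 1) → ℤ}
    (hD : Effective D) (ht : degDiv D ≤ t) :
    ∃ k, k + L ≤ N ∧ ∀ x : Fin (N + 1), k < x.val → x.val ≤ k + L → D x = 0 := by
  by_contra! hcon
  have hblock : ∀ j : Fin (t + 1), ∃ x : Fin (N + 1), j.val * L < x.val ∧
      x.val ≤ j.val * L + L ∧ D x ≠ 0 := fun j =>
    hcon (j.val * L) (le_trans (by nlinarith [j.isLt]) hN)
  choose g hg1 hg2 hg3 using hblock
  have hinj : Function.Injective g := by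
    have hlt : ∀ i j : Fin (t + 1), i < j → (g i).val < (g j).val := fun i j hij => by
      have h : i.val + 1 ≤ j.val := hij
      have := Nat.mul_le_mul_right L h
      have := hg2 i
      have := hg1 j
      rw [add_mul] at *
      omega
    intro i j hij
    rcases lt_trichotomy i j with h | h | h
    · have := hlt i j h
      rw [hij] at this
      omega
    · exact h
    · have := hlt j i h
      rw [hij] at this
      omega
  have h1 : ((t + 1 : ℕ) : ℤ) ≤ degDiv D := by
    calc ((t + 1 : ℕ) : ℤ) = ∑ j : Fin (t + 1), 1 := by simp
      _ ≤ ∑ j, D (g j) := Finset.sum_le_sum fun j _ => by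
          have := hD (g j)
          have := hg3 j
          omega
      _ = ∑ x ∈ Finset.univ.image g, D x := (Finset.sum_image fun _ _ _ _ h => hinj h).symm
      _ ≤ degDiv D := Finset.sum_le_univ_sum_of_nonneg hD
  push_cast at h1
  omega

theorem exists_eq_hub {t N : ℕ} {S D : Fin (N + 1) → ℤ} (hD : Effective D)
    (hD' : Effective (D - lap (fan N) S)) (ht : degDiv D ≤ t) (m : ℕ) (hm : m + 2 * t ≤ N) :
    ∃ i : Fin (N + 1), m ≤ i.val ∧ i.val ≤ m + 2 * t ∧ S i = S 0 := by
  by_contra! hcon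
  have h1 := card_ne_le_of_linEquiv fan_adj_zero hD hD'
  have h2 : (Finset.univ.image fun j : Fin (2 * t + 1) =>
      (⟨m + j.val, by omega⟩ : Fin (N + 1))) ⊆ Finset.univ.filter fun v => S v ≠ S 0 := by
    intro x hx
    obtain ⟨j, -, rfl⟩ := Finset.mem_image.1 hx
    simp only [Finset.mem_filter, Finset.mem_univ, true_and]
    exact hcon _ (by simp) (by simp only; omega)
  have h3 := Finset.card_le_card h2
  rw [Finset.card_image_of_injective _ (fun i j hij => by
    simpa [Fin.ext_iff] using hij)] at h3
  simp only [Finset.card_univ, Fintype.card_fin] at h3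
  omega

theorem lt_degDiv_fan {t N : ℕ} (hN : (t + 1) * (6 * t + 10) ≤ N) {D : Fin (N + 1) → ℤ}
    (hD : Effective D) (hr : PosRank (fan N) D) : (t : ℤ) < degDiv D := by
  by_contra! ht
  obtain ⟨k, hk, hzero⟩ := exists_block_eq_zero hN hD ht
  obtain ⟨_, hD', ⟨S, rfl⟩, hv⟩ := hr ⟨k + 2 * t + 2 + 1, by omega⟩
  obtain ⟨a, ha1, ha2, ha⟩ := exists_eq_hub hD hD' ht (k + 1) (by omega)
  obtain ⟨b, hb1, hb2, hb⟩ := exists_eq_hub hD hD' ht (k + 2 * t + 4) (by omega)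
  obtain ⟨c, hc1, hc2, hc⟩ := exists_eq_hub hD hD' ht (k + 4 * t + 5) (by omega)
  let f : ℕ → ℤ := fun i => if h : i < N + 1 then S ⟨i, h⟩ - S 0 else 0
  have hf : ∀ i (h : i < N + 1), f i = S ⟨i, h⟩ - S 0 := fun i h => dif_pos h
  have hlap : ∀ u, 1 ≤ u → (h : u + 2 ≤ N) →
      lap (fan N) S ⟨u + 1, by omega⟩ = 3 * f (u + 1) - f u - f (u + 2) := by
    intro u hu h
    rw [fan_lap hu h, hf _ (by omega), hf _ (by omega), hf _ (by omega)]
    ring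
  have hle := le_three_mul_of_zeros (f := f) (a := a.val) (v := k + 2 * t + 2) (b := b.val)
    (c := c.val) (by omega) (by omega) (by omega) (by simp [hf a.val a.isLt, ha])
    (by simp [hf b.val b.isLt, hb]) (by simp [hf c.val c.isLt, hc]) (by
      intro u hau huc
      have h1 := hD' ⟨u + 1, by omega⟩
      rw [Pi.sub_apply, hlap u (by omega) (by omega),
        hzero _ (by simp only; omega) (by simp only; omega)] at h1
      omega)
  rw [Pi.sub_apply, hlap _ (by omega) (by omega),
    hzero _ (by simp only; omega) (by simp only; omega)] at hv
  omega

theorem lt_gonality_fan {t N : ℕ} (hN : (t + 1) * (6 * t + 10) ≤ N) : t < gonality (fan N) := by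
  have hne : {n : ℕ | ∃ D : Fin (N + 1) → ℤ, Effective D ∧ PosRank (fan N) D ∧
      degDiv D = (n : ℤ)}.Nonempty :=
    ⟨N + 1, fun _ => 1, fun _ => zero_le_one,
      fun _ => ⟨fun _ => 1, fun _ => zero_le_one, ⟨0, by ext; simp [lap]⟩, le_rfl⟩,
      by simp [degDiv]⟩
  obtain ⟨D, hD, hr, hn⟩ := Nat.sInf_mem hne
  have := lt_degDiv_fan hN hD hr
  rw [hn] at this
  exact_mod_cast this

/-- For every integer `t ≥ 0` there exist connected graphs `G` and `H` such that
`H` is a minor of `G`, `gon(G) = 2` and `gon(H) > t`. -/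
theorem stmt_9 (t : ℕ) :
    ∃ (n m : ℕ) (G : SimpleGraph (Fin n)) (H : SimpleGraph (Fin m)),
      G.Connected ∧ H.Connected ∧ IsMinor H G ∧ gonality G = 2 ∧ t < gonality H := by
  have hN : 2 ≤ (t + 1) * (6 * t + 10) := by nlinarith
  exact ⟨_, _, ladder _, fan _, ladder_connected (by omega), fan_connected _,
    fan_isMinor_ladder (by omega), gonality_ladder hN, lt_gonality_fan le_rfl⟩
end
end
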